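/- Let n, m ≥ 5 and let w : List Bool be a word containing exactly n entries equal to true and m entries equal to false. Let w₀ be the word A^{n−2}BAB^{m−2}AB, i.e., the list consisting of (n−2) copies of true, then false, then true, then (m−2) copies of false, then true, then false. If w is a cyclic rotation of w₀ (i.e., w = w₀.rotate k for some k), then the coefficient of X⁴ in T(w) equals 1; otherwise the coefficient of X⁴ in T(w) equals 0. -/

import Mathlib

open Matrix Polynomial

/-- The polynomial matrix `𝔸`. -/
noncomputable def Apoly : Matrix (Fin 3) (Fin 3) (Polynomial ℝ) :=
  !![1, 0, 0; 0, X, -X; 0, -X, X]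

/-- The polynomial matrix `𝔹`. -/
noncomputable def Bpoly : Matrix (Fin 3) (Fin 3) (Polynomial ℝ) :=
  !![X, -X, 0; -X, X, 0; 0, 0, 1]

/-- The word trace polynomial `T(w)`. -/
noncomputable def T (w : List Bool) : Polynomial ℝ :=
  ((w.map fun b => if b = true then Apoly else Bpoly).prod).trace

/-- `Walk w i j d`: the word `w` labels a walk from state `i` to state `j` along nonzero entries of
the matrices `𝔸`, `𝔹`, exactly `d` of which are entries `± X`. -/
inductive Walk : List Bool → Fin 3 → Fin 3 → ℕ → Prop
  | nil (i : Fin 3) : Walk [] i i 0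
  | freeA {w j d} : Walk w 0 j d → Walk (true :: w) 0 j d
  | freeB {w j d} : Walk w 2 j d → Walk (false :: w) 2 j d
  | costA {w i k j d} : i ≠ 0 → k ≠ 0 → Walk w k j d → Walk (true :: w) i j (d + 1)
  | costB {w i k j d} : i ≠ 2 → k ≠ 2 → Walk w k j d → Walk (false :: w) i j (d + 1)

/-- The product of the matrices along a word. -/
noncomputable def wordProd (w : List Bool) : Matrix (Fin 3) (Fin 3) (Polynomial ℝ) :=
  (w.map fun b => if b = true then Apoly else Bpoly).prod

lemma wordProd_cons (b : Bool) (w : List Bool) :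
    wordProd (b :: w) = (if b = true then Apoly else Bpoly) * wordProd w := by
  simp [wordProd]

lemma wordProd_append (u v : List Bool) : wordProd (u ++ v) = wordProd u * wordProd v := by
  simp [wordProd]

lemma T_append_comm (u v : List Bool) : T (u ++ v) = T (v ++ u) := by
  change (wordProd (u ++ v)).trace = (wordProd (v ++ u)).trace
  rw [wordProd_append, wordProd_append, Matrix.trace_mul_comm]

lemma T_eq_of_isRotated {u v : List Bool} (h : u ~r v) : T u = T v := by
  obtain ⟨k, hk, rfl⟩ := List.isRotated_iff_mod.1 h
  rw [List.rotate_eq_drop_append_take hk, T_append_comm, List.take_append_drop]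

lemma Walk.of_coeff_ne_zero (w : List Bool) (i j : Fin 3) (d : ℕ)
    (h : (wordProd w i j).coeff d ≠ 0) : Walk w i j d := by
  induction w generalizing i d with
  | nil =>
    have hij : i = j := by
      by_contra hij
      simp [wordProd, hij] at h
    subst hij
    have hd : d = 0 := by
      by_contra hd
      simp [wordProd, coeff_one, hd] at h
    subst hd
    exact .nil i
  | cons b w ih =>
    have hcost : ∀ k k' : Fin 3, ∀ s : ℝ, (X * (wordProd w k j - wordProd w k' j)).coeff d * s ≠ 0 →
        ∃ e, d = e + 1 ∧ (Walk w k j e ∨ Walk w k' j e) := by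
      intro k k' s hs
      have hs := left_ne_zero_of_mul hs
      cases d with
      | zero => simp at hs
      | succ e =>
        refine ⟨e, rfl, ?_⟩
        rw [coeff_X_mul, coeff_sub] at hs
        by_contra! hc
        have h1 : (wordProd w k j).coeff e = 0 := by
          by_contra h1
          exact hc.1 (ih k e h1)
        have h2 : (wordProd w k' j).coeff e = 0 := by
          by_contra h2
          exact hc.2 (ih k' e h2)
        simp [h1, h2] at hs
    rw [wordProd_cons, Matrix.mul_apply, Fin.sum_univ_three] at h
    cases b
    · by_cases hi : i = 2
      · subst hi
        refine .freeB (ih 2 d ?_)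
        simpa [Bpoly] using h
      · obtain ⟨e, rfl, h' | h'⟩ := hcost 0 1 (if i = 0 then 1 else -1) (by
          fin_cases i
          · simpa [Bpoly, mul_sub, ← sub_eq_add_neg] using h
          · intro hc
            apply h
            simp [mul_sub] at hc
            simp [Bpoly]
            linarith
          · exact absurd rfl hi)
        · exact .costB hi (by decide) h'
        · exact .costB hi (by decide) h'
    · by_cases hi : i = 0
      · subst hi
        refine .freeA (ih 0 d ?_)
        simpa [Apoly] using h
      · obtain ⟨e, rfl, h' | h'⟩ := hcost 1 2 (if i = 1 then 1 else -1) (by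
          fin_cases i
          · exact absurd rfl hi
          · simpa [Apoly, mul_sub, ← sub_eq_add_neg] using h
          · intro hc
            apply h
            simp [mul_sub] at hc
            simp [Apoly]
            linarith)
        · exact .costA hi (by decide) h'
        · exact .costA hi (by decide) h'

lemma Walk.append {u v : List Bool} {i j k : Fin 3} {d e : ℕ} (h : Walk u i k d)
    (h' : Walk v k j e) : Walk (u ++ v) i j (d + e) := by
  induction h with
  | nil => simpa using h'
  | freeA _ ih => exact .freeA (ih h')
  | freeB _ ih => exact .freeB (ih h')
  | costA hi hk _ ih =>
    rw [Nat.add_right_comm]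
    exact .costA hi hk (ih h')
  | costB hi hk _ ih =>
    rw [Nat.add_right_comm]
    exact .costB hi hk (ih h')

lemma Walk.map_not {w : List Bool} {i j : Fin 3} {d : ℕ} (h : Walk w i j d) :
    Walk (w.map not) i.rev j.rev d := by
  induction h with
  | nil => exact .nil _
  | freeA _ ih => exact .freeB ih
  | freeB _ ih => exact .freeA ih
  | costA hi hk _ ih => exact .costB (by grind) (by grind) ih
  | costB hi hk _ ih => exact .costA (by grind) (by grind) ih

lemma Walk.exists_leave_one {w : List Bool} {i j : Fin 3} {d : ℕ} (h : Walk w i j d)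
    (hi : i = 1) :
    w.length ≤ d ∨ ∃ u v k e f, w = u ++ v ∧ d = e + f ∧ k ≠ 1 ∧ Walk u i k e ∧ Walk v k j f := by
  induction h with
  | nil => simp
  | freeA _ _ => exact absurd hi (by decide)
  | freeB _ _ => exact absurd hi (by decide)
  | @costA w i k j d h0 hk h ih =>
    by_cases h1 : k = 1
    · rcases ih h1 with h' | ⟨u, v, l, e, f, rfl, rfl, hl, hu, hv⟩
      · left; simpa using h'
      · exact .inr ⟨true :: u, v, l, e + 1, f, rfl, by omega, hl, .costA h0 hk hu, hv⟩
    · exact .inr ⟨[true], w, k, 1, d, rfl, by omega, h1, .costA h0 hk (.nil k), h⟩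
  | @costB w i k j d h0 hk h ih =>
    by_cases h1 : k = 1
    · rcases ih h1 with h' | ⟨u, v, l, e, f, rfl, rfl, hl, hu, hv⟩
      · left; simpa using h'
      · exact .inr ⟨false :: u, v, l, e + 1, f, rfl, by omega, hl, .costB h0 hk hu, hv⟩
    · exact .inr ⟨[false], w, k, 1, d, rfl, by omega, h1, .costB h0 hk (.nil k), h⟩

/-- The cheapest walks into state `0`. -/
lemma Walk.cheapest_to_zero {w : List Bool} {i j : Fin 3} {d : ℕ} (h : Walk w i j d) (hj : j = 0) :
    i.val ≤ d ∧ (d = i.val →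
      (i = 0 → ∃ c, w = List.replicate c true) ∧
      (i = 1 → ∃ c, w = false :: List.replicate c true) ∧
      (i = 2 → ∃ b c, w = List.replicate b false ++ true :: false :: List.replicate c true)) := by
  induction h with
  | nil => simp [hj]
  | freeA _ ih =>
    obtain ⟨-, h2⟩ := ih hj
    refine ⟨by simp, fun hd => ⟨fun _ => ?_, by simp, by simp⟩⟩
    obtain ⟨c, rfl⟩ := (h2 hd).1 rfl
    exact ⟨c + 1, rfl⟩
  | freeB _ ih =>
    obtain ⟨h1, h2⟩ := ih hj
    refine ⟨h1, fun hd => ⟨by simp, by simp, fun _ => ?_⟩⟩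
    obtain ⟨b, c, rfl⟩ := (h2 hd).2.2 rfl
    exact ⟨b + 1, c, rfl⟩
  | @costA w i k j d h0 hk h ih =>
    obtain ⟨h1, h2⟩ := ih hj
    refine ⟨by grind, fun hd => ⟨by grind, by grind, fun hi => ?_⟩⟩
    have hk1 : k = 1 := by grind
    subst hi hk1
    obtain ⟨c, rfl⟩ := (h2 (by simpa using hd)).2.1 rfl
    exact ⟨0, c, rfl⟩
  | @costB w i k j d h0 hk h ih =>
    obtain ⟨h1, h2⟩ := ih hj
    refine ⟨by grind, fun hd => ⟨by grind, fun hi => ?_, by grind⟩⟩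
    have hk1 : k = 0 := by grind
    subst hi hk1
    obtain ⟨c, rfl⟩ := (h2 (by simpa using hd)).1 rfl
    exact ⟨c, rfl⟩

/-- A walk into state `0` either pays for every letter `B`, or visits state `2`, and the cheapest
walks of the latter kind are explicit. -/
lemma Walk.to_zero_cases {w : List Bool} {i j : Fin 3} {d : ℕ} (h : Walk w i j d)
    (hj : j = 0) :
    (i = 0 → w.count false ≤ d ∨ 4 < d ∨ d = 4 ∧ ∃ a b c, w = List.replicate a true ++
      false :: true :: (List.replicate b false ++ true :: false :: List.replicate c true)) ∧
    (i = 1 → w.count false ≤ d ∨ 3 < d ∨ d = 3 ∧ ∃ b c, w =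
      true :: (List.replicate b false ++ true :: false :: List.replicate c true)) := by
  induction h with
  | nil => simp
  | freeA _ ih =>
    refine ⟨fun _ => ?_, by simp⟩
    rcases (ih hj).1 rfl with h | h | ⟨h, a, b, c, rfl⟩
    · left; simpa using h
    · exact .inr (.inl h)
    · exact .inr (.inr ⟨h, a + 1, b, c, rfl⟩)
  | freeB _ ih => simp
  | @costA w i k j d h0 hk h ih =>
    refine ⟨fun hi => absurd hi h0, fun hi => ?_⟩
    by_cases h1 : k = 1
    · rcases (ih hj).2 h1 with h | h | ⟨h, -⟩
      · left; simp; omega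
      · right; left; omega
      · right; left; omega
    · have h2 : k = 2 := by grind
      subst h2
      obtain ⟨hd, hc⟩ := h.cheapest_to_zero hj
      simp only [Fin.val_two] at hd hc
      rcases hd.eq_or_lt with hd | hd
      · obtain ⟨b, c, rfl⟩ := (hc hd.symm).2.2 trivial
        exact .inr (.inr ⟨by omega, b, c, rfl⟩)
      · right; left; omega
  | @costB w i k j d h0 hk h ih =>
    have h01 : k = 0 ∨ k = 1 := by grind
    refine ⟨fun hi => ?_, fun hi => ?_⟩
    · rcases h01 with rfl | rfl
      · rcases (ih hj).1 rfl with h | h | ⟨h, -⟩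
        · left; simpa using h
        · right; left; omega
        · right; left; omega
      · rcases (ih hj).2 rfl with h | h | ⟨h, b, c, rfl⟩
        · left; simpa using h
        · right; left; omega
        · exact .inr (.inr ⟨by omega, 0, b, c, rfl⟩)
    · rcases h01 with rfl | rfl
      · rcases (ih hj).1 rfl with h | h | ⟨h, -⟩
        · left; simpa using h
        · right; left; omega
        · right; left; omega
      · rcases (ih hj).2 rfl with h | h | ⟨h, -⟩
        · left; simpa using h
        · right; left; omega
        · right; left; omega

/-- The word `A^a B A B^b A B`. -/
def extremalWord (a b : ℕ) : List Bool :=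
  List.replicate a true ++ [false, true] ++ List.replicate b false ++ [true, false]

lemma Walk.isRotated_of_zero {w : List Bool} (h : Walk w 0 0 4) (hB : 5 ≤ w.count false) :
    w ~r extremalWord (w.count true - 2) (w.count false - 2) := by
  rcases (h.to_zero_cases rfl).1 rfl with h | h | ⟨-, a, b, c, rfl⟩
  · omega
  · omega
  · have hA : (List.replicate a true ++ false :: true :: (List.replicate b false ++
        true :: false :: List.replicate c true)).count true - 2 = c + a := by
      simp [List.count_replicate]; omega
    have hB : (List.replicate a true ++ false :: true :: (List.replicate b false ++
        true :: false :: List.replicate c true)).count false - 2 = b := by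
      simp [List.count_replicate]
    rw [hA, hB, extremalWord, List.replicate_add]
    simpa [-List.replicate_append_replicate] using List.isRotated_append (l := List.replicate a true ++ [false, true] ++
      List.replicate b false ++ [true, false]) (l' := List.replicate c true)

lemma map_not_extremalWord_isRotated (a b : ℕ) :
    (extremalWord a b).map not ~r extremalWord b a := by
  simpa [extremalWord] using List.isRotated_append
    (l := List.replicate a false ++ [true, false]) (l' := List.replicate b true ++ [false, true])

lemma Walk.isRotated_of_two {w : List Bool} (h : Walk w 2 2 4) (hA : 5 ≤ w.count true) :
    w ~r extremalWord (w.count true - 2) (w.count false - 2) := by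
  have hT : (w.map not).count true = w.count false := by
    simpa using List.count_map_of_injective w not Bool.not_injective false
  have hF : (w.map not).count false = w.count true := by
    simpa using List.count_map_of_injective w not Bool.not_injective true
  have h' := (Walk.isRotated_of_zero h.map_not (by omega)).map not
  rw [hT, hF] at h'
  simpa [Function.comp_def] using h'.trans (map_not_extremalWord_isRotated _ _)

lemma Walk.isRotated {w : List Bool} {i : Fin 3} (h : Walk w i i 4) (hA : 5 ≤ w.count true)
    (hB : 5 ≤ w.count false) :
    w ~r extremalWord (w.count true - 2) (w.count false - 2) := by
  have key : ∀ {v : List Bool} {k : Fin 3}, k ≠ 1 → Walk v k k 4 → 5 ≤ v.count true →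
      5 ≤ v.count false → v ~r extremalWord (v.count true - 2) (v.count false - 2) := by
    intro v k hk h hA hB
    have : k = 0 ∨ k = 2 := by grind
    rcases this with rfl | rfl
    · exact h.isRotated_of_zero hB
    · exact h.isRotated_of_two hA
  by_cases hi : i = 1
  · rcases h.exists_leave_one hi with h' | ⟨u, v, k, e, f, rfl, hd, hk, hu, hv⟩
    · have := List.count_le_length (a := true) (l := w)
      omega
    · have hvu := hv.append hu
      rw [Nat.add_comm, ← hd] at hvu
      have hp : (v ++ u).Perm (u ++ v) := List.perm_append_comm
      have := key hk hvu (by rwa [hp.count_eq]) (by rwa [hp.count_eq])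
      rw [hp.count_eq, hp.count_eq] at this
      exact List.isRotated_append.trans this
  · exact key hi h hA hB

lemma wordProd_replicate_true (a : ℕ) :
    wordProd (List.replicate (a + 1) true) =
      !![1, 0, 0; 0, X * (2 * X) ^ a, -(X * (2 * X) ^ a);
        0, -(X * (2 * X) ^ a), X * (2 * X) ^ a] := by
  induction a with
  | zero => simp [wordProd, Apoly]
  | succ a ih =>
    rw [List.replicate_succ, wordProd_cons, ih]
    ext1 i j
    fin_cases i <;> fin_cases j <;> simp [Apoly, Matrix.mul_apply, Fin.sum_univ_three] <;> ring

lemma wordProd_replicate_false (a : ℕ) :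
    wordProd (List.replicate (a + 1) false) =
      !![X * (2 * X) ^ a, -(X * (2 * X) ^ a), 0; -(X * (2 * X) ^ a), X * (2 * X) ^ a, 0;
        0, 0, 1] := by
  induction a with
  | zero => simp [wordProd, Bpoly]
  | succ a ih =>
    rw [List.replicate_succ, wordProd_cons, ih]
    ext1 i j
    fin_cases i <;> fin_cases j <;> simp [Bpoly, Matrix.mul_apply, Fin.sum_univ_three] <;> ring

lemma coeff_T_extremalWord (a b : ℕ) : (T (extremalWord (a + 3) (b + 3))).coeff 4 = 1 := by
  have h : ∃ q : Polynomial ℝ, T (extremalWord (a + 3) (b + 3)) = X ^ 4 + X ^ 5 * q := by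
    change ∃ q : Polynomial ℝ, (wordProd (extremalWord (a + 3) (b + 3))).trace = _
    obtain ⟨p, hp⟩ : ∃ p : Polynomial ℝ, X * (2 * X) ^ (a + 2) = X ^ 3 * p :=
      ⟨4 * (2 * X) ^ a, by ring⟩
    obtain ⟨q, hq⟩ : ∃ q : Polynomial ℝ, X * (2 * X) ^ (b + 2) = X ^ 3 * q :=
      ⟨4 * (2 * X) ^ b, by ring⟩
    refine ⟨(1 + X) ^ 2 * (p + q) + X ^ 3 * (2 + X) ^ 2 * p * q, ?_⟩
    rw [extremalWord, wordProd_append, wordProd_append, wordProd_append,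
      wordProd_replicate_true, wordProd_replicate_false, hp, hq]
    simp only [wordProd, List.map_cons, List.map_nil, List.prod_cons, List.prod_nil, mul_one,
      Apoly, Bpoly, if_true, Bool.false_eq_true, if_false]
    simp [Matrix.trace_fin_three]
    ring
  obtain ⟨q, hq⟩ := h
  rw [hq, coeff_add, coeff_X_pow, coeff_X_pow_mul']
  simp

theorem stmt_9 (n m : ℕ) (hn : 5 ≤ n) (hm : 5 ≤ m) (w : List Bool)
    (hwn : w.count true = n) (hwm : w.count false = m)
    (w₀ : List Bool)
    (hw₀ : w₀ = List.replicate (n - 2) true ++ [false, true] ++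
      List.replicate (m - 2) false ++ [true, false]) :
    ((∃ k : ℕ, w = w₀.rotate k) → (T w).coeff 4 = 1) ∧
      (¬ (∃ k : ℕ, w = w₀.rotate k) → (T w).coeff 4 = 0) := by
  change w₀ = extremalWord (n - 2) (m - 2) at hw₀
  subst hw₀
  refine ⟨?_, fun hrot => ?_⟩
  · rintro ⟨k, hk⟩
    rw [← T_eq_of_isRotated ⟨k, hk.symm⟩]
    obtain ⟨a, rfl⟩ := Nat.exists_eq_add_of_le' hn
    obtain ⟨b, rfl⟩ := Nat.exists_eq_add_of_le' hm
    exact coeff_T_extremalWord a b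
  · by_contra hne
    apply hrot
    have hi : ∃ i, (wordProd w i i).coeff 4 ≠ 0 := by
      by_contra! hall
      apply hne
      change ((wordProd w).trace).coeff 4 = 0
      simp [Matrix.trace_fin_three, hall]
    obtain ⟨i, hi⟩ := hi
    obtain ⟨k, hk⟩ := ((Walk.of_coeff_ne_zero w i i 4 hi).isRotated (by omega) (by omega)).symm
    rw [hwn, hwm] at hk
    exact ⟨k, hk.symm⟩
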